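/- Let ω ∉ {ε, ab, ba, aba} be a factor of F_∞. Then: (1) ω has exactly two distinct gaps, i.e., the set {ν_{ω,p} : p ≥ 1} has exactly two elements, namely ν_{ω,1} and ν_{ω,2}, and ν_{ω,1} ≠ ν_{ω,2}; (2) the gap sequence {ν_{ω,p}}_{p≥1} is the Fibonacci word over the alphabet {ν_{ω,1}, ν_{ω,2}}: for every p ≥ 1, ν_{ω,p} = ν_{ω,1} if the p-th letter of F_∞ is a, and ν_{ω,p} = ν_{ω,2} if the p-th letter of F_∞ is b. -/

import Mathlib

/-- Finite Fibonacci words: `Fw k = σ^k(a)` where `a = false`, `b = true`,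
`σ(a) = ab`, `σ(b) = a`; so `Fw (k+2) = Fw (k+1) ++ Fw k`. -/
def Fw : ℕ → List Bool
  | 0 => [false]
  | 1 => [false, true]
  | (k+2) => Fw (k+1) ++ Fw k

/-- The infinite Fibonacci word `F_∞` (0-indexed): since `Fw (n+1)` has length
`fib (n+3) > n`, its `n`-th letter is the `n`-th letter of `F_∞`. -/
def fw (n : ℕ) : Bool := (Fw (n+1)).getD n false

/-- Singular words, with index shifted by one: `sw n = s_{n-1}`.
`sw 0 = s_{-1} = a`, and `sw (n+1) = s_n = β_n · F_n · α_n⁻¹` where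
`α_n` is the last letter of `F_n` and `β_n` the other letter. -/
def sw : ℕ → List Bool
  | 0 => [false]
  | (n+1) => (!((Fw n).getLastD false)) :: (Fw n).dropLast

/-- The factor of `F_∞` of length `n` starting at (0-indexed) position `i`. -/
def seg (i n : ℕ) : List Bool := (List.range n).map (fun t => fw (i + t))

/-- `w` occurs in `F_∞` at (0-indexed) position `i`. -/
def OccursAt (w : List Bool) (i : ℕ) : Prop := seg i w.length = w

/-- `w` is a factor of `F_∞`. -/
def IsFactor (w : List Bool) : Prop := ∃ i, OccursAt w i

/-- Starting position of the `(p+1)`-st occurrence of `w` in `F_∞`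
(occurrences enumerated by starting position, 0-indexed: `occPos w 0`
is the first occurrence, i.e. the paper's `ω_1`). -/
noncomputable def occPos (w : List Bool) (p : ℕ) : ℕ := Nat.nth (OccursAt w) p

/-- A finite word viewed as an element of the free group on the alphabet. -/
def listToFree (w : List Bool) : FreeGroup Bool := (w.map FreeGroup.of).prod

/-- The gap `ν_{w,p}` (0-indexed in `p`: `gap w 0` is the paper's `ν_{w,1}`)
between the `(p+1)`-st and `(p+2)`-nd occurrences of `w`, as an element of the
free group: the separating word if the occurrences are separated or adjacent,
and the formal inverse of the overlap if they overlap. -/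
noncomputable def gap (w : List Bool) (p : ℕ) : FreeGroup Bool :=
  if occPos w p + w.length ≤ occPos w (p+1) then
    listToFree (seg (occPos w p + w.length) (occPos w (p+1) - (occPos w p + w.length)))
  else
    (listToFree (seg (occPos w (p+1)) (occPos w p + w.length - occPos w (p+1))))⁻¹

/-- The signed length `|ν_{w,p}|` of the gap (negative in the overlapped case). -/
noncomputable def gapLen (w : List Bool) (p : ℕ) : ℤ :=
  (occPos w (p+1) : ℤ) - ((occPos w p : ℤ) + (w.length : ℤ))

/-- `u` is a singular word (some `s_k`, `k ≥ -1`). -/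
def IsSingular (u : List Bool) : Prop := ∃ n, u = sw n

/-- `u` is a singular kernel of `w`: a singular factor of `w` of maximal length. -/
def IsKernelOf (u w : List Bool) : Prop :=
  IsSingular u ∧ u <:+: w ∧ ∀ v : List Bool, IsSingular v → v <:+: w → v.length ≤ u.length

/-- The excluded words `{ε, ab, ba, aba}`. -/
def excl : List (List Bool) := [[], [false, true], [true, false], [false, true, false]]

/-- The `i`-th conjugate `C_i(w)` (indices taken mod the length). -/
def conj (i : ℕ) (w : List Bool) : List Bool :=
  w.drop (i % w.length) ++ w.take (i % w.length)

/-- `sliceW u i j = u[i,j]`, the letters `i` through `j` of `u`, 1-indexed. -/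
def sliceW (u : List Bool) (i j : ℕ) : List Bool := (u.take j).drop (i - 1)

/-- The Fibonacci morphism `σ` on finite words. -/
def fibMorph (w : List Bool) : List Bool :=
  w.flatMap fun c => if c then [false] else [false, true]

/-- The morphism `σ` extended to the free group. -/
def fibHom : FreeGroup Bool →* FreeGroup Bool :=
  FreeGroup.lift fun c => listToFree (fibMorph [c])

/-- The starting position in `F_∞ = σ(F_∞)` of the image of the `n`-th letter of `F_∞`. -/
def imagePos (n : ℕ) : ℕ := (fibMorph (seg 0 n)).length

/-- The prefix of length `n` of `F_∞`, as an element of the free group. -/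
def prefixFree (n : ℕ) : FreeGroup Bool := listToFree (seg 0 n)

/-- The occurrences of `w` are enumerated by a strictly increasing sequence whose successive
return words form the Fibonacci word over two distinct letters. -/
def HasFibReturns (w : List Bool) : Prop :=
  ∃ x : ℕ → ℕ, StrictMono x ∧ (∀ i, OccursAt w i ↔ ∃ p, x p = i) ∧
    ∃ A B : FreeGroup Bool, A ≠ B ∧
      ∀ p, prefixFree (x (p + 1)) = prefixFree (x p) * if fw p = false then A else B

section Words

theorem length_seg (i n : ℕ) : (seg i n).length = n := by simp [seg]

theorem seg_add (i m n : ℕ) : seg i (m + n) = seg i m ++ seg (i + m) n := by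
  simp [seg, List.range_add, Function.comp_def, add_assoc]

theorem seg_one (i : ℕ) : seg i 1 = [fw i] := by simp [seg]

theorem occursAt_append (u v : List Bool) (i : ℕ) :
    OccursAt (u ++ v) i ↔ OccursAt u i ∧ OccursAt v (i + u.length) := by
  unfold OccursAt
  rw [List.length_append, seg_add]
  exact ⟨fun h => List.append_inj h (length_seg _ _), fun ⟨hu, hv⟩ => by rw [hu, hv]⟩

theorem occursAt_nil (i : ℕ) : OccursAt [] i := by simp [OccursAt, seg]

theorem occursAt_cons (c : Bool) (w : List Bool) (i : ℕ) :
    OccursAt (c :: w) i ↔ fw i = c ∧ OccursAt w (i + 1) := by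
  rw [← List.singleton_append, occursAt_append]
  simp [OccursAt, seg_one]

theorem listToFree_append (u v : List Bool) :
    listToFree (u ++ v) = listToFree u * listToFree v := by
  simp [listToFree]

theorem fibMorph_append (u v : List Bool) : fibMorph (u ++ v) = fibMorph u ++ fibMorph v := by
  simp [fibMorph]

theorem fibMorph_cons (c : Bool) (w : List Bool) :
    fibMorph (c :: w) = (if c then [false] else [false, true]) ++ fibMorph w := by
  simp [fibMorph]

theorem listToFree_fibMorph (w : List Bool) :
    listToFree (fibMorph w) = fibHom (listToFree w) := by
  induction w with
  | nil => simp [fibMorph, listToFree]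
  | cons c w ih =>
    rw [← List.singleton_append, fibMorph_append, listToFree_append, listToFree_append, map_mul, ih]
    simp [fibHom, listToFree]

theorem fibHom_injective : Function.Injective fibHom := by
  let inv : FreeGroup Bool →* FreeGroup Bool := FreeGroup.lift fun c =>
    if c then (FreeGroup.of true)⁻¹ * FreeGroup.of false else FreeGroup.of true
  have h : inv.comp fibHom = MonoidHom.id _ := by
    ext c
    cases c <;> simp [inv, fibHom, fibMorph, listToFree]
  exact Function.LeftInverse.injective (g := inv) fun g => DFunLike.congr_fun h g

theorem fibMorph_Fw : ∀ k, fibMorph (Fw k) = Fw (k + 1)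
  | 0 => rfl
  | 1 => rfl
  | k + 2 => by
    rw [Fw, fibMorph_append, fibMorph_Fw (k + 1), fibMorph_Fw k]
    rfl

theorem lt_length_Fw : ∀ k, k < (Fw k).length
  | 0 => by simp [Fw]
  | 1 => by simp [Fw]
  | k + 2 => by
    have h₁ := lt_length_Fw (k + 1)
    have h₂ := lt_length_Fw k
    rw [Fw, List.length_append]
    omega

theorem Fw_prefix_succ : ∀ k, Fw k <+: Fw (k + 1)
  | 0 => ⟨[true], rfl⟩
  | k + 1 => ⟨Fw k, rfl⟩

theorem Fw_prefix {j k : ℕ} (h : j ≤ k) : Fw j <+: Fw k := by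
  induction h with
  | refl => exact List.prefix_rfl
  | step _ ih => exact ih.trans (Fw_prefix_succ _)

theorem fw_eq_getElem {k n : ℕ} (h : n < (Fw k).length) : fw n = (Fw k)[n] := by
  have hn : n < (Fw (n + 1)).length := (Nat.lt_succ_self n).trans (lt_length_Fw _)
  rw [fw, List.getD_eq_getElem _ _ hn]
  rcases le_total (n + 1) k with hk | hk
  · exact (Fw_prefix hk).getElem hn
  · exact ((Fw_prefix hk).getElem h).symm

theorem occursAt_Fw (k : ℕ) : OccursAt (Fw k) 0 := by
  refine List.ext_getElem (length_seg _ _) fun n _ h => ?_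
  simp [seg, fw_eq_getElem h]

theorem occursAt_fibMorph_seg (n : ℕ) : OccursAt (fibMorph (seg 0 n)) 0 := by
  obtain ⟨t, ht⟩ : seg 0 n <+: Fw n := by
    rw [← occursAt_Fw n]
    obtain ⟨m, hm⟩ := Nat.exists_eq_add_of_le (lt_length_Fw n).le
    rw [hm, seg_add]
    exact List.prefix_append _ _
  have h := occursAt_Fw (n + 1)
  rw [← fibMorph_Fw, ← ht, fibMorph_append, occursAt_append] at h
  exact h.1

end Words

section ImagePos

theorem imagePos_succ (n : ℕ) : imagePos (n + 1) = imagePos n + if fw n then 1 else 2 := by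
  rw [imagePos, seg_add, seg_one, fibMorph_append, List.length_append, zero_add, ← imagePos]
  cases fw n <;> rfl

theorem occursAt_fibMorph_letter (n : ℕ) : OccursAt (fibMorph [fw n]) (imagePos n) := by
  have h := occursAt_fibMorph_seg (n + 1)
  rw [seg_add, seg_one, fibMorph_append, occursAt_append, zero_add, zero_add] at h
  exact h.2

theorem fw_imagePos (n : ℕ) : fw (imagePos n) = false := by
  have h := occursAt_fibMorph_letter n
  cases hn : fw n <;> simp_all [fibMorph, occursAt_cons]

theorem fw_imagePos_add_one {n : ℕ} (hn : fw n = false) : fw (imagePos n + 1) = true := by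
  have h := occursAt_fibMorph_letter n
  simp_all [fibMorph, occursAt_cons]

theorem imagePos_strictMono : StrictMono imagePos :=
  strictMono_nat_of_lt_succ fun n => by
    rw [imagePos_succ]
    split <;> omega

theorem add_le_imagePos_add (n k : ℕ) : imagePos n + k ≤ imagePos (n + k) := by
  induction k with
  | zero => rfl
  | succ k ih => exact Nat.succ_le_of_lt (ih.trans_lt (imagePos_strictMono (Nat.lt_succ_self _)))

theorem add_lt_imagePos_add {n : ℕ} (hn : fw n = false) (k : ℕ) :
    imagePos n + (k + 1) < imagePos (n + (k + 1)) := by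
  have h := add_le_imagePos_add (n + 1) k
  simp only [imagePos_succ, hn, Bool.false_eq_true, if_false] at h
  rw [← add_assoc, add_right_comm, add_comm k, ← add_assoc]
  omega

theorem exists_imagePos (i : ℕ) :
    ∃ n, i = imagePos n ∨ (fw n = false ∧ i = imagePos n + 1) := by
  induction i with
  | zero => exact ⟨0, Or.inl rfl⟩
  | succ i ih =>
    obtain ⟨n, rfl | ⟨hn, rfl⟩⟩ := ih
    · cases hn : fw n
      · exact ⟨n, Or.inr ⟨hn, rfl⟩⟩
      · exact ⟨n + 1, Or.inl (by simp [imagePos_succ, hn])⟩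
    · exact ⟨n + 1, Or.inl (by simp [imagePos_succ, hn])⟩

theorem exists_imagePos_of_fw_false {i : ℕ} (hi : fw i = false) : ∃ n, i = imagePos n := by
  obtain ⟨n, rfl | ⟨hn, rfl⟩⟩ := exists_imagePos i
  · exact ⟨n, rfl⟩
  · simp [fw_imagePos_add_one hn] at hi

theorem exists_imagePos_of_fw_true {i : ℕ} (hi : fw i = true) :
    ∃ n, fw n = false ∧ i = imagePos n + 1 := by
  obtain ⟨n, rfl | h⟩ := exists_imagePos i
  · simp [fw_imagePos] at hi
  · exact ⟨n, h⟩

theorem fw_succ_of_fw_true {i : ℕ} (hi : fw i = true) : fw (i + 1) = false := by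
  obtain ⟨n, hn, rfl⟩ := exists_imagePos_of_fw_true hi
  have h : imagePos n + 1 + 1 = imagePos (n + 1) := by simp [imagePos_succ, hn]
  rw [h, fw_imagePos]

theorem seg_imagePos (n k : ℕ) :
    seg (imagePos n) (imagePos (n + k) - imagePos n) = fibMorph (seg n k) := by
  have h := occursAt_fibMorph_seg (n + k)
  rw [seg_add, fibMorph_append, occursAt_append, zero_add, zero_add] at h
  have hl : imagePos (n + k) = imagePos n + (fibMorph (seg n k)).length := by
    rw [imagePos, seg_add, fibMorph_append, List.length_append, zero_add, ← imagePos]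
  rw [hl, Nat.add_sub_cancel_left]
  exact h.2

theorem prefixFree_imagePos (n : ℕ) : prefixFree (imagePos n) = fibHom (prefixFree n) := by
  rw [prefixFree, prefixFree, ← listToFree_fibMorph]
  exact congrArg listToFree (occursAt_fibMorph_seg n)

theorem prefixFree_add (i n : ℕ) : prefixFree (i + n) = prefixFree i * listToFree (seg i n) := by
  rw [prefixFree, seg_add, listToFree_append, zero_add, prefixFree]

theorem occursAt_fibMorph_append_imagePos (v : List Bool) (n : ℕ) :
    OccursAt (fibMorph v ++ [false]) (imagePos n) ↔ OccursAt v n := by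
  induction v generalizing n with
  | nil => simp [fibMorph, occursAt_cons, occursAt_nil, fw_imagePos]
  | cons c v ih =>
    have hn := imagePos_succ n
    rw [fibMorph_cons, List.append_assoc, occursAt_append, occursAt_cons, ← ih (n + 1)]
    cases c <;> cases h : fw n
    · simp [h] at hn
      simp [occursAt_cons, occursAt_nil, fw_imagePos, fw_imagePos_add_one h, hn]
    · simp [h] at hn
      simp [occursAt_cons, ← hn, fw_imagePos]
    · have hb := fw_imagePos_add_one h
      have hstart : ¬ OccursAt (fibMorph v ++ [false]) (imagePos n + 1) := by
        rcases v with _ | ⟨_ | _, v⟩ <;> simp [fibMorph, occursAt_cons, hb]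
      simp [hstart]
    · simp [h] at hn
      simp [occursAt_cons, occursAt_nil, fw_imagePos, hn]

theorem occursAt_fibMorph_append (v : List Bool) (i : ℕ) :
    OccursAt (fibMorph v ++ [false]) i ↔ ∃ n, OccursAt v n ∧ imagePos n = i := by
  constructor
  · intro h
    have hi : fw i = false := by
      rcases v with _ | ⟨_ | _, v⟩ <;> simp_all [fibMorph, occursAt_cons]
    obtain ⟨n, rfl⟩ := exists_imagePos_of_fw_false hi
    exact ⟨n, (occursAt_fibMorph_append_imagePos v n).1 h, rfl⟩
  · rintro ⟨n, h, rfl⟩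
    exact (occursAt_fibMorph_append_imagePos v n).2 h

end ImagePos

section Returns

theorem hasFibReturns_nil : HasFibReturns [] := by
  refine ⟨id, strictMono_id, fun i => ⟨fun _ => ⟨i, rfl⟩, fun _ => occursAt_nil i⟩,
    FreeGroup.of false, FreeGroup.of true, FreeGroup.of_injective.ne (by decide), fun p => ?_⟩
  rw [id, id, prefixFree_add, seg_one]
  cases fw p <;> simp [listToFree]

theorem HasFibReturns.fibMorph_append {v : List Bool} (h : HasFibReturns v) :
    HasFibReturns (fibMorph v ++ [false]) := by
  obtain ⟨x, hx, hocc, A, B, hAB, hret⟩ := h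
  refine ⟨imagePos ∘ x, imagePos_strictMono.comp hx, fun i => ?_, fibHom A, fibHom B,
    fibHom_injective.ne hAB, fun p => ?_⟩
  · simp [occursAt_fibMorph_append, hocc]
  · simp only [Function.comp_apply, prefixFree_imagePos, hret, map_mul, apply_ite fibHom]

theorem HasFibReturns.of_cons {w : List Bool} (h : HasFibReturns (false :: true :: w)) :
    HasFibReturns (true :: w) := by
  obtain ⟨x, hx, hocc, A, B, hAB, hret⟩ := h
  have hstep (p : ℕ) : prefixFree (x p + 1) = prefixFree (x p) * FreeGroup.of false := by
    have := ((occursAt_cons _ _ _).1 ((hocc (x p)).2 ⟨p, rfl⟩)).1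
    rw [prefixFree_add, seg_one, this]
    simp [listToFree]
  refine ⟨fun p => x p + 1, fun _ _ hpq => Nat.succ_lt_succ (hx hpq), fun i => ⟨fun hi => ?_, ?_⟩,
    (FreeGroup.of false)⁻¹ * A * FreeGroup.of false,
    (FreeGroup.of false)⁻¹ * B * FreeGroup.of false, by simpa using hAB, fun p => ?_⟩
  · obtain ⟨n, -, rfl⟩ := exists_imagePos_of_fw_true ((occursAt_cons _ _ _).1 hi).1
    obtain ⟨p, hp⟩ := (hocc (imagePos n)).1 ((occursAt_cons _ _ _).2 ⟨fw_imagePos n, hi⟩)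
    exact ⟨p, congrArg (· + 1) hp⟩
  · rintro ⟨p, rfl⟩
    exact ((occursAt_cons _ _ _).1 ((hocc (x p)).2 ⟨p, rfl⟩)).2
  · simp only [hstep, hret]
    split <;> group

theorem HasFibReturns.of_append {w : List Bool} (h : HasFibReturns (w ++ [true] ++ [false])) :
    HasFibReturns (w ++ [true]) := by
  obtain ⟨x, hx, hocc, hret⟩ := h
  refine ⟨x, hx, fun i => ?_, hret⟩
  rw [← hocc, occursAt_append (w ++ [true])]
  refine ⟨fun hi => ⟨hi, ?_⟩, And.left⟩
  have hb := ((occursAt_append _ _ _).1 hi).2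
  simp only [occursAt_cons, occursAt_nil, and_true, List.length_append, List.length_singleton]
    at hb ⊢
  exact fw_succ_of_fw_true hb

/-- Extending a nonempty factor to the left and to the right until both end letters are `a`
turns it into `σ(v)a` for a factor `v` of `F_∞`. -/
theorem hasFibReturns_seg_of_extension {i L n k : ℕ}
    (hn : i = imagePos n ∨ (fw n = false ∧ i = imagePos n + 1))
    (hk : i + L = imagePos (n + k) ∨ (fw (i + L) = true ∧ i + L + 1 = imagePos (n + k)))
    (h : HasFibReturns (seg n k)) : HasFibReturns (seg i (L + 1)) := by
  have hmono := imagePos_strictMono.monotone (Nat.le_add_right n k)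
  have hlast := fw_imagePos (n + k)
  have hext : HasFibReturns (seg (imagePos n) (imagePos (n + k) - imagePos n + 1)) := by
    have hfac := h.fibMorph_append
    rwa [← seg_imagePos, ← hlast, ← seg_one, ← Nat.add_sub_cancel' hmono,
      Nat.add_sub_cancel_left, ← seg_add] at hfac
  have hleft : HasFibReturns (seg i (imagePos (n + k) - i + 1)) := by
    rcases hn with rfl | ⟨hn, rfl⟩
    · exact hext
    · obtain ⟨d, hd⟩ : ∃ d, imagePos (n + k) = imagePos n + 1 + d :=
        Nat.exists_eq_add_of_le (by omega)
      rw [hd, Nat.add_sub_cancel_left, add_comm d, seg_add, seg_one, fw_imagePos_add_one hn]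
      rw [hd, add_assoc, Nat.add_sub_cancel_left, add_assoc, seg_add, seg_one, add_comm d,
        seg_add, seg_one, fw_imagePos, fw_imagePos_add_one hn] at hext
      exact hext.of_cons
  rcases hk with hk | ⟨hb, hk⟩
  · rwa [← hk, Nat.add_sub_cancel_left] at hleft
  · rw [← hk, add_assoc i, Nat.add_sub_cancel_left, seg_add, seg_one, add_assoc i L 1 |>.symm,
      fw_succ_of_fw_true hb] at hleft
    rw [seg_add, seg_one, hb] at hleft ⊢
    exact hleft.of_append

theorem hasFibReturns_seg (L i : ℕ) : HasFibReturns (seg i L) := by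
  induction L using Nat.strong_induction_on generalizing i with
  | _ L ih =>
  rcases L with _ | L
  · exact hasFibReturns_nil
  obtain ⟨n, hn⟩ := exists_imagePos i
  cases hb : fw (i + L)
  · obtain ⟨m, hm⟩ := exists_imagePos_of_fw_false hb
    obtain ⟨k, rfl⟩ : ∃ k, m = n + k :=
      Nat.exists_eq_add_of_le (imagePos_strictMono.le_iff_le.1 (by omega))
    refine hasFibReturns_seg_of_extension hn (Or.inl hm) (ih k ?_ n)
    have hle := add_le_imagePos_add n k
    rcases hn with rfl | ⟨hn, rfl⟩
    · omega
    · rcases k with _ | k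
      · omega
      · have := add_lt_imagePos_add hn k
        omega
  · obtain ⟨m, hm, hmi⟩ := exists_imagePos_of_fw_true hb
    have hms : i + L + 1 = imagePos (m + 1) := by
      simp [imagePos_succ, hm, hmi]
    obtain ⟨k, rfl⟩ : ∃ k, m = n + k :=
      Nat.exists_eq_add_of_le (Nat.lt_succ_iff.1 (imagePos_strictMono.lt_iff_lt.1
        (show imagePos n < imagePos (m + 1) by omega)))
    refine hasFibReturns_seg_of_extension hn (k := k + 1) (Or.inr ⟨hb, hms⟩) ?_
    have hle := add_le_imagePos_add n k
    rcases k with _ | k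
    · rw [seg_one, show fw n = false from hm]
      exact hasFibReturns_nil.fibMorph_append
    · refine ih _ ?_ n
      rcases hn with rfl | ⟨hn, rfl⟩
      · omega
      · have := add_lt_imagePos_add hn k
        omega

theorem HasFibReturns.gap_eq {w : List Bool} (h : HasFibReturns w) :
    ∃ A B : FreeGroup Bool, A ≠ B ∧ ∀ p, gap w p = if fw p = false then A else B := by
  obtain ⟨x, hx, hocc, A, B, hAB, hret⟩ := h
  have hpos (p : ℕ) : occPos w p = x p := by
    have hinf : (Set.ofPred (OccursAt w)).Infinite :=
      (Set.infinite_range_of_injective hx.injective).mono fun i hi => (hocc i).2 hi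
    have h := Nat.nth_comp_of_strictMono (n := p) hx (fun i hi => (hocc i).1 hi)
      fun hf => absurd hf hinf
    simp only [fun q => (hocc (x q)).2 ⟨q, rfl⟩, Nat.nth_true] at h
    exact h.symm
  refine ⟨(listToFree w)⁻¹ * A, (listToFree w)⁻¹ * B, by simpa using hAB, fun p => ?_⟩
  have hend : prefixFree (x p + w.length) = prefixFree (x p) * listToFree w := by
    rw [prefixFree_add]
    exact congrArg _ (congrArg _ ((hocc (x p)).2 ⟨p, rfl⟩))
  have hgap : gap w p = (prefixFree (x p + w.length))⁻¹ * prefixFree (x (p + 1)) := by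
    rw [gap, hpos, hpos]
    split
    · next hle =>
      obtain ⟨m, hm⟩ := Nat.exists_eq_add_of_le hle
      rw [hm, Nat.add_sub_cancel_left, prefixFree_add (x p + w.length), inv_mul_cancel_left]
    · next hle =>
      obtain ⟨m, hm⟩ := Nat.exists_eq_add_of_le (not_le.1 hle).le
      rw [hm, Nat.add_sub_cancel_left, prefixFree_add (x (p + 1))]
      group
  rw [hgap, hend, hret]
  split <;> group

end Returns

/-- every factor `ω ∉ {ε,ab,ba,aba}` of `F_∞` has exactly two distinct
gaps `ν_{ω,1} = gap ω 0` and `ν_{ω,2} = gap ω 1`, and the gap sequence is the Fibonacci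
word over `{ν_{ω,1}, ν_{ω,2}}`: `ν_{ω,p} = ν_{ω,1}` iff the `p`-th letter of `F_∞` is `a`. -/
theorem stmt9 (ω : List Bool) (hfac : IsFactor ω) (hne : ω ∉ excl) :
    (gap ω 0 ≠ gap ω 1 ∧
      {g : FreeGroup Bool | ∃ p : ℕ, gap ω p = g} = {gap ω 0, gap ω 1}) ∧
    (∀ p : ℕ, gap ω p = if fw p = false then gap ω 0 else gap ω 1) := by
  obtain ⟨i, hi⟩ := hfac
  obtain ⟨A, B, hAB, hgap⟩ := (hi ▸ hasFibReturns_seg ω.length i : HasFibReturns ω).gap_eq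
  have h₀ : gap ω 0 = A := hgap 0
  have h₁ : gap ω 1 = B := hgap 1
  rw [h₀, h₁]
  refine ⟨⟨hAB, Set.ext fun g => ⟨?_, ?_⟩⟩, hgap⟩
  · rintro ⟨p, rfl⟩
    rw [hgap]
    split <;> simp
  · rintro (rfl | rfl)
    · exact ⟨0, h₀⟩
    · exact ⟨1, h₁⟩
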